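/- Let n ≥ 2 and let w₁ < w₂ < ⋯ < w_{n−1} be real numbers, and let S be the set of normalized real polynomials P of degree n whose ramification type at each w_j is (2,1,…,1) (every w_j a simple branch point). Then the signed count Σ_{P∈S} ε(P) equals the (n−1)-st derivative at q = 0 of tanh(q) if n is even, and the (n−1)-st derivative at q = 0 of 1/cosh(q) if n is odd. (This expresses the identities F^even_∅ = tanh and F^odd_∅ = 1/cosh for the generating series of s-numbers of polynomials with only simple branch points.) -/

import Mathlib

open Polynomial
open scoped Classical

/-- The ramification type of `w` for a real polynomial `P`: the multiset of
multiplicities of the complex roots of `P - w`. -/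
noncomputable def ramType (P : Polynomial ℝ) (w : ℝ) : Multiset ℕ :=
  ((P.map (algebraMap ℝ ℂ) - Polynomial.C (w : ℂ)).roots.toFinset.val).map
    fun z => (P.map (algebraMap ℝ ℂ) - Polynomial.C (w : ℂ)).rootMultiplicity z

/-- A disorder of `P`: a pair `x₁ < x₂` with `P x₁ = P x₂` and the multiplicity of `x₁`
as a root of `P - P x₁` strictly greater than that of `x₂`. -/
def disorders (P : Polynomial ℝ) : Set (ℝ × ℝ) :=
  {p | p.1 < p.2 ∧ P.eval p.1 = P.eval p.2 ∧
    (P - Polynomial.C (P.eval p.2)).rootMultiplicity p.2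
      < (P - Polynomial.C (P.eval p.1)).rootMultiplicity p.1}

/-- The sign `ε(P) = (-1)^{number of disorders}`. -/
noncomputable def epsilonP (P : Polynomial ℝ) : ℤ := (-1) ^ Nat.card (disorders P)

/-- `P = X^n + a₂ X^(n-2) + ⋯ + a_n`: monic of degree `n` with vanishing coefficient
of `X^(n-1)`. -/
def IsNormalized (n : ℕ) (P : Polynomial ℝ) : Prop :=
  P.natDegree = n ∧ P.Monic ∧ P.coeff (n - 1) = 0

/-- A multiset of positive integers summing to `n`. -/
def IsPartitionOf (n : ℕ) (Λ : Multiset ℕ) : Prop := Λ.sum = n ∧ 0 ∉ Λ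

/-- The set of normalized real degree-`n` polynomials all of whose `n-1` branch points
`w 0 < w 1 < ⋯ < w (n-2)` are simple, i.e. have ramification type `(2,1,…,1)`. -/
noncomputable def simpleSet (n : ℕ) (w : Fin (n - 1) → ℝ) : Set (Polynomial ℝ) :=
  {P | IsNormalized n P ∧
    ∀ j, ramType P (w j) = 2 ::ₘ Multiset.replicate (n - 2) 1}

theorem bij_of_proper_localHomeo {E X : Type*} [TopologicalSpace E] [TopologicalSpace X]
    [T2Space E] [T2Space X] [PathConnectedSpace E] [SimplyConnectedSpace X]
    (p : E → X) (hl : IsLocalHomeomorph p) (hp : IsProperMap p) : Function.Bijective p := by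
  have cov : IsCoveringMap p := by
    rw [isCoveringMap_iff_isCoveringMapOn_univ]
    refine hp.isClosedMap.isCoveringMapOn_of_isLocalHomeomorphOn (fun x _ => ?_) ?_
    · refine (hp.isCompact_preimage isCompact_singleton).finite ?_
      refine IsDiscrete.of_openPartialHomeomorph p subset_rfl fun e _ => ?_
      obtain ⟨φ, h, h'⟩ := hl e
      exact ⟨φ, h, h'.symm⟩
    · exact fun x _ => hl x
  constructor
  · intro e₀ e₁ h
    let Γ : Path e₀ e₁ := PathConnectedSpace.somePath e₀ e₁
    have h1 := cov.monodromy_eq_of_map_eq (x := p e₀) (y := p e₀) (γ := .refl (p e₀))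
      (ex := ⟨e₀, rfl⟩) (ey := ⟨e₁, h.symm⟩) (.mk Γ) (Subsingleton.elim _ _)
    rw [cov.monodromy_refl] at h1
    exact congrArg Subtype.val h1
  · have : IsClopen (Set.range p) := ⟨hp.isClosedMap.isClosed_range, hl.isOpenMap.isOpen_range⟩
    rw [← Set.range_eq_univ]
    exact this.eq_univ (Set.range_nonempty p)

theorem isLocalHomeomorph_of_open_locInj {E X : Type*} [TopologicalSpace E] [TopologicalSpace X]
    (p : E → X) (hc : Continuous p) (ho : IsOpenMap p)
    (hi : ∀ e, ∃ U ∈ nhds e, Set.InjOn p U) : IsLocalHomeomorph p := by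
  rw [isLocalHomeomorph_iff_isOpenEmbedding_restrict]
  intro e
  obtain ⟨U, hU, hinj⟩ := hi e
  obtain ⟨V, hVU, hV, heV⟩ := mem_nhds_iff.1 hU
  refine ⟨V, hV.mem_nhds heV, .of_continuous_injective_isOpenMap (hc.comp continuous_subtype_val) (Set.injOn_iff_injective.1 (hinj.mono hVU)) ?_⟩
  exact ho.comp hV.isOpenMap_subtype_val

def alt : Bool → List ℝ → Prop
  | _, [] => True
  | _, [_] => True
  | b, x :: y :: l => (if b then x < y else y < x) ∧ alt (!b) (y :: l)

theorem alt_append_max (M : ℝ) (l₂ : List ℝ) (h₂ : ∀ y ∈ l₂, y < M) : ∀ (l₁ : List ℝ) (b : Bool),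
    (∀ y ∈ l₁, y < M) → (l₁ ≠ [] ∨ l₂ ≠ []) →
    (alt b (l₁ ++ M :: l₂) ↔ Nat.bodd l₁.length = b ∧ alt b l₁ ∧ alt true l₂)
  | [], b, h₁, hne => by
    cases l₂ with
    | nil => simp at hne
    | cons y l =>
      have := h₂ y (by simp)
      cases b <;> simp [alt, this, this.le]
  | [x], b, h₁, hne => by
    have hx := h₁ x (by simp)
    cases l₂ with
    | nil => cases b <;> simp [alt, hx, hx.le]
    | cons y l =>
      have := h₂ y (by simp)
      cases b <;> simp [alt, this, this.le, hx]
  | x :: y :: l, b, h₁, hne => by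
    have ih := alt_append_max M l₂ h₂ (y :: l) (!b) (fun z hz => h₁ z (by simp at hz ⊢; tauto)) (by simp)
    simp only [List.cons_append, alt] at ih ⊢
    rw [ih]
    simp only [List.length_cons, Nat.bodd_succ]
    cases b <;> cases Nat.bodd l.length <;> simp <;> tauto

/-- alternating lists with underlying set `W` -/
noncomputable def altFin (W : Finset ℝ) : Finset (List ℝ) :=
  (W.toList.permutations.toFinset).filter (alt true)

theorem mem_altFin {W : Finset ℝ} {l : List ℝ} :
    l ∈ altFin W ↔ l.Nodup ∧ l.toFinset = W ∧ alt true l := by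
  unfold altFin
  rw [Finset.mem_filter, List.mem_toFinset, List.mem_permutations, ← and_assoc]
  refine and_congr_left fun _ => ?_
  constructor
  · intro h
    refine ⟨h.nodup_iff.2 W.nodup_toList, ?_⟩
    rw [List.toFinset_eq_of_perm _ _ h, Finset.toList_toFinset]
  · rintro ⟨h, rfl⟩
    refine (List.perm_ext_iff_of_nodup h (Finset.nodup_toList _)).2 fun a => ?_
    simp

theorem length_of_mem_altFin {W : Finset ℝ} {l : List ℝ} (h : l ∈ altFin W) : l.length = W.card := by
  rw [mem_altFin] at h
  rw [← h.2.1, List.toFinset_card_of_nodup h.1]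

theorem card_altFin_step (W : Finset ℝ) (M : ℝ) (hM : ∀ y ∈ W, y < M) (hW : W.Nonempty) :
    (altFin (insert M W)).card =
      ∑ R ∈ W.powerset, if Nat.bodd R.card then (altFin R).card * (altFin (W \ R)).card else 0 := by
  have hMW : M ∉ W := fun h => lt_irrefl _ (hM M h)
  rw [← Finset.sum_filter]
  simp_rw [← Finset.card_product]
  rw [← Finset.card_sigma]
  symm
  refine Finset.card_bij (fun (s : (_ : Finset ℝ) × (List ℝ × List ℝ)) _ => s.2.1 ++ M :: s.2.2) ?_ ?_ ?_
  · rintro ⟨R, l₁, l₂⟩ h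
    simp only [Finset.mem_sigma, Finset.mem_filter, Finset.mem_powerset, Finset.mem_product] at h
    obtain ⟨⟨hR, hodd⟩, h1, h2⟩ := h
    have hl := length_of_mem_altFin h1
    rw [mem_altFin] at h1 h2
    obtain ⟨n1, t1, a1⟩ := h1
    obtain ⟨n2, t2, a2⟩ := h2
    have m1 : ∀ y, y ∈ l₁ ↔ y ∈ R := fun y => by rw [← t1, List.mem_toFinset]
    have m2 : ∀ y, y ∈ l₂ ↔ y ∈ W ∧ y ∉ R := fun y => by
      rw [← List.mem_toFinset, t2, Finset.mem_sdiff]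
    rw [mem_altFin]
    refine ⟨?_, ?_, ?_⟩
    · rw [List.nodup_append]
      refine ⟨n1, ?_, ?_⟩
      · rw [List.nodup_cons]
        exact ⟨fun h => hMW ((m2 M).1 h).1, n2⟩
      · intro a ha b hb hab
        subst hab
        rw [List.mem_cons] at hb
        rcases hb with rfl | hb
        · exact hMW (hR ((m1 _).1 ha))
        · exact ((m2 _).1 hb).2 ((m1 _).1 ha)
    · ext y
      simp only [List.toFinset_append, List.toFinset_cons, t1, t2, Finset.mem_union,
        Finset.mem_insert, Finset.mem_sdiff]
      constructor
      · rintro (h | h | h)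
        · exact Or.inr (hR h)
        · exact Or.inl h
        · exact Or.inr h.1
      · rintro (h | h)
        · tauto
        · by_cases hy : y ∈ R <;> tauto
    · refine (alt_append_max M l₂ (fun y hy => hM y ((m2 y).1 hy).1) l₁ true
        (fun y hy => hM y (hR ((m1 y).1 hy))) ?_).2 ⟨by rw [hl]; exact hodd, a1, a2⟩
      left
      rintro rfl
      simp at hl
      rw [← hl] at hodd
      simp at hodd
  · rintro ⟨R, l₁, l₂⟩ h ⟨R', l₁', l₂'⟩ h' heq
    simp only [Finset.mem_sigma, Finset.mem_filter, Finset.mem_powerset, Finset.mem_product, mem_altFin] at h h' heq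
    have hn : M ∉ l₁ := fun hh => hMW (h.1.1 (by rw [← h.2.1.2.1]; simpa using hh))
    have hn' : M ∉ l₁' := fun hh => hMW (h'.1.1 (by rw [← h'.2.1.2.1]; simpa using hh))
    have hn2 : M ∉ l₂ := fun hh => hMW ((Finset.sdiff_subset : W \ R ⊆ W) (by rw [← h.2.2.2.1]; simpa using hh))
    have key : l₁ = l₁' ∧ l₂ = l₂' := by
      have := (List.append_eq_append_iff).1 heq
      rcases this with ⟨as, h1, h2⟩ | ⟨as, h1, h2⟩
      · cases as with
        | nil => simp at h1 h2; exact ⟨h1.symm, h2⟩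
        | cons c as =>
          simp at h2; rw [← h2.1] at h1; rw [h1] at hn'; simp at hn'
      · cases as with
        | nil => simp at h1 h2; exact ⟨h1, h2.symm⟩
        | cons c as =>
          simp at h2; rw [← h2.1] at h1; rw [h1] at hn; simp at hn
    obtain ⟨rfl, rfl⟩ := key
    have : R = R' := by rw [← h.2.1.2.1, ← h'.2.1.2.1]
    subst this
    rfl
  · intro l hl
    rw [mem_altFin] at hl
    obtain ⟨n, t, a⟩ := hl
    have hMl : M ∈ l := by rw [← List.mem_toFinset, t]; simp
    obtain ⟨l₁, l₂, rfl⟩ := List.append_of_mem hMl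
    rw [List.nodup_append, List.nodup_cons] at n
    obtain ⟨n1, ⟨nM, n2⟩, n3⟩ := n
    have m : ∀ y, (y ∈ l₁ ∨ y = M ∨ y ∈ l₂) ↔ (y = M ∨ y ∈ W) := fun y => by
      rw [← Finset.mem_insert, ← t]; simp; tauto
    have hM1 : M ∉ l₁ := fun h => n3 M h M (by simp) rfl
    have s1 : ∀ y ∈ l₁, y ∈ W := fun y hy => by
      rcases (m y).1 (Or.inl hy) with rfl | h
      · exact absurd hy hM1
      · exact h
    have s2 : ∀ y ∈ l₂, y ∈ W := fun y hy => by
      rcases (m y).1 (Or.inr (Or.inr hy)) with rfl | h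
      · exact absurd hy nM
      · exact h
    have hne : l₁ ≠ [] ∨ l₂ ≠ [] := by
      obtain ⟨y, hy⟩ := hW
      rcases (m y).2 (Or.inr hy) with h | h | h
      · left; exact List.ne_nil_of_mem h
      · subst h; exact absurd hy hMW
      · right; exact List.ne_nil_of_mem h
    obtain ⟨b, a1, a2⟩ := (alt_append_max M l₂ (fun y hy => hM y (s2 y hy)) l₁ true
        (fun y hy => hM y (s1 y hy)) hne).1 a
    refine ⟨⟨l₁.toFinset, l₁, l₂⟩, ?_, rfl⟩
    simp only [Finset.mem_sigma, Finset.mem_filter, Finset.mem_powerset, Finset.mem_product, mem_altFin]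
    refine ⟨⟨fun y hy => s1 y (by simpa using hy), ?_⟩, ⟨n1, trivial, a1⟩, n2, ?_, a2⟩
    · rw [List.toFinset_card_of_nodup n1]; exact b
    · ext y
      simp only [List.mem_toFinset, Finset.mem_sdiff]
      constructor
      · intro hy
        exact ⟨s2 y hy, fun h => n3 y h y (by simp [hy]) rfl⟩
      · rintro ⟨h1, h2⟩
        rcases (m y).2 (Or.inr h1) with h | h | h
        · exact absurd h h2
        · subst h; exact absurd h1 hMW
        · exact h

theorem card_altFin_rec (A : ℕ → ℝ) (h0 : A 0 = 1) (h1 : A 1 = 1)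
    (hr : ∀ k, 0 < k → A (k + 1) = ∑ j ∈ Finset.range (k + 1),
      (k.choose j : ℝ) * (if Nat.bodd j then A j * A (k - j) else 0)) :
    ∀ (m : ℕ) (W : Finset ℝ), W.card = m → ((altFin W).card : ℝ) = A m := by
  intro m
  induction m using Nat.strong_induction_on with
  | _ m ih =>
  intro W hW
  by_cases hm0 : m = 0
  · subst hm0
    rw [Finset.card_eq_zero] at hW
    subst hW
    have : altFin ∅ = {[]} := by
      ext l; rw [mem_altFin]; simp
      constructor
      · tauto
      · rintro rfl; simp [alt]
    rw [this, h0]; simp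
  by_cases hm1 : m = 1
  · subst hm1
    obtain ⟨a, rfl⟩ := Finset.card_eq_one.1 hW
    have : altFin {a} = {[a]} := by
      ext l
      constructor
      · intro h
        have hl := length_of_mem_altFin h
        rw [mem_altFin] at h
        obtain ⟨x, rfl⟩ := List.length_eq_one_iff.1 (by simpa using hl)
        simpa using h.2.1
      · intro h
        rw [Finset.mem_singleton] at h
        subst h
        rw [mem_altFin]; simp [alt]
    rw [this, h1]; simp
  have hne : W.Nonempty := by rw [← Finset.card_pos]; omega
  set M := W.max' hne with hMdef
  have hMW : M ∈ W := Finset.max'_mem _ _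
  obtain ⟨k, rfl⟩ : ∃ k, m = k + 1 := ⟨m - 1, by omega⟩
  have hk : (W.erase M).card = k := by rw [Finset.card_erase_of_mem hMW, hW]; rfl
  have := card_altFin_step (W.erase M) M (fun y hy => by
    rw [Finset.mem_erase] at hy
    exact lt_of_le_of_ne (Finset.le_max' _ _ hy.2) hy.1) (by rw [← Finset.card_pos]; omega)
  rw [Finset.insert_erase hMW] at this
  rw [this, hr k (by omega)]
  push_cast
  have hs := Finset.sum_powerset_apply_card (fun j => if Nat.bodd j then A j * A (k - j) else 0) (x := W.erase M)
  rw [hk] at hs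
  simp only [nsmul_eq_mul] at hs
  rw [← hs]
  refine Finset.sum_congr rfl fun R hR => ?_
  rw [Finset.mem_powerset] at hR
  have hc := Finset.card_le_card hR
  split_ifs with hb
  · rw [ih R.card (by omega) R rfl, ih (k - R.card) (by omega) (W.erase M \ R) (by rw [Finset.card_sdiff_of_subset hR, hk])]
  · rfl

theorem cd_tanh : ContDiff ℝ ⊤ Real.tanh := by
  have : Real.tanh = fun x => Real.sinh x / Real.cosh x := by
    funext x; exact Real.tanh_eq_sinh_div_cosh x
  rw [this]
  exact Real.contDiff_sinh.div Real.contDiff_cosh fun x => (Real.cosh_pos x).ne'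

theorem cd_sech : ContDiff ℝ ⊤ (fun x : ℝ => 1 / Real.cosh x) :=
  contDiff_const.div Real.contDiff_cosh fun x => (Real.cosh_pos x).ne'

theorem deriv_tanh' : deriv Real.tanh = fun x => 1 - Real.tanh x * Real.tanh x := by
  have : Real.tanh = fun x => Real.sinh x / Real.cosh x := by
    funext x; exact Real.tanh_eq_sinh_div_cosh x
  rw [this]
  funext x
  have hc := (Real.cosh_pos x).ne'
  rw [((Real.hasDerivAt_sinh x).fun_div (Real.hasDerivAt_cosh x) hc).deriv]
  field_simp

theorem deriv_sech' : deriv (fun x : ℝ => 1 / Real.cosh x) = fun x => - (Real.tanh x * (1 / Real.cosh x)) := by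
  funext x
  have hc := (Real.cosh_pos x).ne'
  rw [((hasDerivAt_const x (1:ℝ)).fun_div (Real.hasDerivAt_cosh x) hc).deriv, Real.tanh_eq_sinh_div_cosh]
  field_simp
  ring

noncomputable def tN (k : ℕ) : ℝ := iteratedDeriv k Real.tanh 0
noncomputable def sN (k : ℕ) : ℝ := iteratedDeriv k (fun x : ℝ => 1 / Real.cosh x) 0

theorem tN_succ (k : ℕ) : tN (k + 1) = (if k = 0 then 1 else 0) -
    ∑ j ∈ Finset.range (k + 1), (k.choose j : ℝ) * tN j * tN (k - j) := by
  unfold tN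
  have ht : ContDiffAt ℝ k Real.tanh 0 := cd_tanh.contDiffAt.of_le le_top
  rw [iteratedDeriv_succ', deriv_tanh']
  rw [iteratedDeriv_fun_sub contDiffAt_const (ht.mul ht), iteratedDeriv_fun_mul ht ht, iteratedDeriv_const]

theorem sN_succ (k : ℕ) : sN (k + 1) =  -
    ∑ j ∈ Finset.range (k + 1), (k.choose j : ℝ) * tN j * sN (k - j) := by
  unfold tN sN
  have ht : ContDiffAt ℝ k Real.tanh 0 := cd_tanh.contDiffAt.of_le le_top
  have hs : ContDiffAt ℝ k (fun x : ℝ => 1 / Real.cosh x) 0 := cd_sech.contDiffAt.of_le le_top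
  rw [iteratedDeriv_succ', deriv_sech']
  rw [iteratedDeriv_fun_neg, iteratedDeriv_fun_mul ht hs]

theorem tN_even (k : ℕ) (hk : Even k) : tN k = 0 := by
  induction k using Nat.strong_induction_on with
  | _ k ih =>
  rcases k with _ | k
  · simp [tN]
  have hko : ¬ Even k := by simpa [Nat.even_add_one] using hk
  rw [tN_succ, if_neg (by rintro rfl; simp at hko), zero_sub, neg_eq_zero]
  refine Finset.sum_eq_zero fun j hj => ?_
  have hjk : j ≤ k := by simpa [Nat.lt_succ_iff] using hj
  by_cases he : Even j
  · rw [ih j (by omega) he]; simp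
  · rw [ih (k - j) (by omega) (by rw [Nat.even_sub hjk]; tauto)]; simp

noncomputable def uN (k : ℕ) : ℝ := if Even k then sN k else tN k
noncomputable def aN (k : ℕ) : ℝ := (-1) ^ (k / 2) * uN k

theorem bodd_iff (j : ℕ) : Nat.bodd j = true ↔ ¬ Even j := by
  rw [Nat.not_even_iff, Nat.mod_two_of_bodd]
  cases j.bodd <;> simp

theorem aN_rec (k : ℕ) (hk0 : 0 < k) : aN (k + 1) = ∑ j ∈ Finset.range (k + 1),
      (k.choose j : ℝ) * (if Nat.bodd j then aN j * aN (k - j) else 0) := by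
  have h1 : uN (k + 1) = - ∑ j ∈ Finset.range (k + 1), (k.choose j : ℝ) * tN j * uN (k - j) := by
    unfold uN
    by_cases he : Even k
    · rw [if_neg (by rw [Nat.even_add_one]; tauto), tN_succ, if_neg hk0.ne', zero_sub]
      congr 1
      refine Finset.sum_congr rfl fun j hj => ?_
      have hjk : j ≤ k := by simpa [Nat.lt_succ_iff] using hj
      by_cases hj : Even j
      · rw [tN_even j hj]; simp
      · rw [if_neg (by rw [Nat.even_sub hjk]; tauto)]
    · rw [if_pos (by rw [Nat.even_add_one]; tauto), sN_succ]
      congr 1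
      refine Finset.sum_congr rfl fun j hj => ?_
      have hjk : j ≤ k := by simpa [Nat.lt_succ_iff] using hj
      by_cases hj : Even j
      · rw [tN_even j hj]; simp
      · rw [if_pos (by rw [Nat.even_sub hjk]; tauto)]
  unfold aN
  rw [h1, ← Finset.sum_neg_distrib, Finset.mul_sum]
  refine Finset.sum_congr rfl fun j hj => ?_
  have hjk : j ≤ k := by simpa [Nat.lt_succ_iff] using hj
  by_cases he : Even j
  · rw [tN_even j he, if_neg (by rw [bodd_iff]; tauto)]; simp
  · rw [if_pos (by rw [bodd_iff]; tauto)]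
    have hu : uN j = tN j := by unfold uN; rw [if_neg he]
    have h2 : (k + 1) / 2 = j / 2 + (k - j) / 2 + 1 := by
      rw [Nat.not_even_iff] at he; omega
    rw [h2, hu, pow_succ, pow_add]; ring

theorem aN_zero : aN 0 = 1 := by simp [aN, uN, sN]
theorem aN_one : aN 1 = 1 := by
  have := tN_succ 0
  simp [tN_even 0] at this
  simp [aN, uN, this]

noncomputable def polyOf {m : ℕ} (a : Fin m → ℝ) : ℝ[X] := X ^ (m + 1) + ∑ k : Fin m, C (a k) * X ^ (k : ℕ)

theorem polyOf_coeff {m : ℕ} (a : Fin m → ℝ) (j : ℕ) :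
    (polyOf a).coeff j = if h : j < m then a ⟨j, h⟩ else if j = m + 1 then 1 else 0 := by
  unfold polyOf
  rw [coeff_add, coeff_X_pow, finsetSum_coeff]
  simp only [coeff_C_mul, coeff_X_pow]
  split_ifs with h1 h2 h2
  · omega
  · rw [Finset.sum_eq_zero]; · simp
    intro k _
    rw [if_neg (by omega)]; simp
  · rw [Finset.sum_eq_single ⟨j, h2⟩]
    · simp
    · intro b _ hb
      rw [if_neg (by rintro rfl; simp at hb)]; simp
    · simp
  · rw [Finset.sum_eq_zero]; · simp
    intro k _
    rw [if_neg (by omega)]; simp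

theorem polyOf_natDegree {m : ℕ} (a : Fin m → ℝ) : (polyOf a).natDegree = m + 1 := by
  refine natDegree_eq_of_le_of_coeff_ne_zero ?_ ?_
  · rw [natDegree_le_iff_coeff_eq_zero]
    intro N hN
    rw [polyOf_coeff, dif_neg (by omega), if_neg (by omega)]
  · rw [polyOf_coeff, dif_neg (by omega), if_pos rfl]; simp

theorem polyOf_monic {m : ℕ} (a : Fin m → ℝ) : (polyOf a).Monic := by
  rw [Monic, leadingCoeff, polyOf_natDegree, polyOf_coeff, dif_neg (by omega), if_pos rfl]

theorem polyOf_injective {m : ℕ} : Function.Injective (polyOf (m := m)) := by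
  intro a b h
  funext k
  have := congrArg (fun p => coeff p (k : ℕ)) h
  simpa [polyOf_coeff] using this

theorem exists_polyOf {m : ℕ} (P : ℝ[X]) (hd : P.natDegree = m + 1) (hm : P.Monic)
    (hc : P.coeff m = 0) : ∃ a : Fin m → ℝ, P = polyOf a := by
  refine ⟨fun k => P.coeff k, ?_⟩
  ext j
  rw [polyOf_coeff]
  split_ifs with h1 h2
  · rfl
  · subst h2; rw [← hd]; exact hm
  · by_cases h : j = m
    · rw [h, hc]
    · exact coeff_eq_zero_of_natDegree_lt (by omega)

theorem polyOf_eval {m : ℕ} (a : Fin m → ℝ) (t : ℝ) :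
    (polyOf a).eval t = t ^ (m + 1) + ∑ k : Fin m, a k * t ^ (k : ℕ) := by
  simp [polyOf, eval_finsetSum]

theorem polyOf_deriv_eval {m : ℕ} (a : Fin m → ℝ) (t : ℝ) :
    (derivative (polyOf a)).eval t = (m + 1) * t ^ m + ∑ k : Fin m, a k * (k * t ^ ((k : ℕ) - 1)) := by
  simp [polyOf, eval_finsetSum, derivative_X_pow]

def IsCrit {m : ℕ} (a x : Fin m → ℝ) : Prop :=
  StrictAnti x ∧ ∀ i, (derivative (polyOf a)).eval (x i) = 0

theorem deriv_coeff_polyOf {m : ℕ} (a : Fin m → ℝ) : (derivative (polyOf a)).coeff m = m + 1 := by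
  rw [coeff_derivative, polyOf_coeff, dif_neg (by omega), if_pos rfl]; simp

theorem IsCrit.deriv_eq {m : ℕ} {a x : Fin m → ℝ} (h : IsCrit a x) :
    derivative (polyOf a) = C ((m : ℝ) + 1) * ∏ i, (X - C (x i)) := by
  have hmonic : (∏ i, (X - C (x i))).Monic := monic_prod_of_monic _ _ fun i _ => monic_X_sub_C _
  have hdeg : (∏ i, (X - C (x i))).natDegree = m := by
    rw [natDegree_prod_of_monic _ _ fun i _ => monic_X_sub_C _]; simp
  have hD : (derivative (polyOf a) - C ((m : ℝ) + 1) * ∏ i, (X - C (x i))).degree < (m : ℕ) := by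
    rw [degree_lt_iff_coeff_zero]
    intro j hj
    rw [coeff_sub, coeff_C_mul]
    rcases hj.eq_or_lt with rfl | hj
    · rw [deriv_coeff_polyOf]
      have : (∏ i, (X - C (x i))).coeff m = 1 := by
        have := hmonic.coeff_natDegree; rwa [hdeg] at this
      rw [this]; ring
    · have h1 : (∏ i, (X - C (x i))).coeff j = 0 := coeff_eq_zero_of_natDegree_lt (by omega)
      have h2 : (derivative (polyOf a)).coeff j = 0 := by
        apply coeff_eq_zero_of_natDegree_lt
        have := natDegree_derivative_le (polyOf a)
        rw [polyOf_natDegree] at this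
        omega
      rw [h1, h2]; simp
  have := eq_zero_of_degree_lt_of_eval_finset_eq_zero (f := (derivative (polyOf a) - C ((m : ℝ) + 1) * ∏ i, (X - C (x i))))
    (s := Finset.univ.image x) (by rw [Finset.card_image_of_injective _ h.1.injective]; simpa using hD) (by
      intro y hy
      rw [Finset.mem_image] at hy
      obtain ⟨i, _, rfl⟩ := hy
      rw [eval_sub, h.2 i, eval_mul, eval_prod, Finset.prod_eq_zero (Finset.mem_univ i)] <;> simp)
  exact sub_eq_zero.1 this

theorem IsCrit.sum_eq_zero {m : ℕ} (hm : 0 < m) {a x : Fin m → ℝ} (h : IsCrit a x) : ∑ i, x i = 0 := by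
  have h1 := congrArg (fun p => coeff p (m - 1)) h.deriv_eq
  simp only [coeff_C_mul] at h1
  have h2 := prod_X_sub_C_coeff_card_pred Finset.univ x (by simpa using hm)
  simp only [Finset.card_univ, Fintype.card_fin] at h2
  rw [h2, coeff_derivative, polyOf_coeff, dif_neg (by omega), if_neg (by omega)] at h1
  have : (m : ℝ) + 1 ≠ 0 := by positivity
  simp at h1
  tauto

theorem continuous_coeff_prod {m : ℕ} (s : Finset (Fin m)) : ∀ j : ℕ,
    Continuous fun x : Fin m → ℝ => (∏ i ∈ s, (X - C (x i))).coeff j := by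
  induction s using Finset.induction_on with
  | empty => intro j; simp; exact continuous_const
  | insert b s hb ih =>
    intro j
    simp_rw [Finset.prod_insert hb, sub_mul, coeff_sub, coeff_C_mul]
    refine Continuous.sub ?_ ((continuous_apply b).mul (ih j))
    cases j with
    | zero => simp; exact continuous_const
    | succ j => simp_rw [coeff_X_mul]; exact ih j

/-- coefficients from critical points and constant term -/
noncomputable def antiC {m : ℕ} (x : Fin m → ℝ) (c : ℝ) (k : Fin m) : ℝ :=
  if (k : ℕ) = 0 then c else ((m : ℝ) + 1) / k * (∏ i, (X - C (x i))).coeff ((k : ℕ) - 1)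

theorem continuous_antiC {m : ℕ} : Continuous fun p : (Fin m → ℝ) × ℝ => antiC p.1 p.2 := by
  refine continuous_pi fun k => ?_
  unfold antiC
  split_ifs
  · exact continuous_snd
  · exact continuous_const.mul ((continuous_coeff_prod Finset.univ ((k : ℕ) - 1)).comp continuous_fst)

theorem IsCrit.eq_antiC {m : ℕ} (hm : 0 < m) {a x : Fin m → ℝ} (h : IsCrit a x) : a = antiC x (a ⟨0, hm⟩) := by
  funext k
  unfold antiC
  split_ifs with hk
  · congr 1; exact Fin.ext hk
  · have h1 := congrArg (fun p => coeff p ((k : ℕ) - 1)) h.deriv_eq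
    simp only [coeff_C_mul] at h1
    have hk' : (k : ℕ) - 1 + 1 = k := by omega
    rw [coeff_derivative, hk', polyOf_coeff, dif_pos k.2] at h1
    have h2 : (((k : ℕ) - 1 : ℕ) : ℝ) + 1 = (k : ℕ) := by exact_mod_cast hk'
    rw [h2] at h1
    have : ((k : ℕ) : ℝ) ≠ 0 := by exact_mod_cast hk
    field_simp
    simpa [mul_comm] using h1

theorem isCrit_antiC {m : ℕ} (hm : 0 < m) {x : Fin m → ℝ} (hx : StrictAnti x) (hs : ∑ i, x i = 0) (c : ℝ) :
    IsCrit (antiC x c) x := by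
  refine ⟨hx, fun i => ?_⟩
  have hmonic : (∏ i, (X - C (x i))).Monic := monic_prod_of_monic _ _ fun i _ => monic_X_sub_C _
  have hdeg : (∏ i, (X - C (x i))).natDegree = m := by
    rw [natDegree_prod_of_monic _ _ fun i _ => monic_X_sub_C _]; simp
  have : derivative (polyOf (antiC x c)) = C ((m : ℝ) + 1) * ∏ i, (X - C (x i)) := by
    ext j
    rw [coeff_derivative, polyOf_coeff, coeff_C_mul]
    split_ifs with h1 h2
    · unfold antiC
      rw [if_neg (by simp)]
      simp
      field_simp
    · have hj : j = m := by omega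
      subst hj
      have : (∏ i, (X - C (x i))).coeff j = 1 := by
        have := hmonic.coeff_natDegree; rwa [hdeg] at this
      rw [this]; ring
    · by_cases hj : j + 1 = m
      · have h2 := prod_X_sub_C_coeff_card_pred Finset.univ x (by simpa using hm)
        simp only [Finset.card_univ, Fintype.card_fin] at h2
        rw [show j = m - 1 by omega, h2, hs]; simp
      · rw [coeff_eq_zero_of_natDegree_lt (by omega : _ < j)]; simp
  rw [this, eval_mul, eval_prod, Finset.prod_eq_zero (Finset.mem_univ i)] <;> simp

theorem IsCrit.deriv2 {m : ℕ} {a x : Fin m → ℝ} (h : IsCrit a x) (i : Fin m) :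
    (derivative (derivative (polyOf a))).eval (x i) = (m + 1) * ∏ j ∈ Finset.univ.erase i, (x i - x j) := by
  rw [h.deriv_eq, derivative_C_mul, eval_mul, eval_C, derivative_prod_finset, eval_finsetSum]
  congr 1
  rw [Finset.sum_eq_single i]
  · simp [eval_prod]
  · intro b _ hb
    rw [eval_mul, eval_prod, Finset.prod_eq_zero (i := i)]
    · simp
    · simp [hb.symm]
    · simp
  · simp

theorem IsCrit.deriv2_ne {m : ℕ} {a x : Fin m → ℝ} (h : IsCrit a x) (i : Fin m) :
    (derivative (derivative (polyOf a))).eval (x i) ≠ 0 := by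
  rw [h.deriv2]
  refine mul_ne_zero (by positivity) (Finset.prod_ne_zero_iff.2 fun j hj => ?_)
  rw [sub_ne_zero]
  intro h'
  simp at hj
  exact hj (h.1.injective h').symm

theorem prod_sign {ι : Type*} (s : Finset ι) (f : ι → ℝ) (hf : ∀ i ∈ s, f i ≠ 0) :
    0 < (-1) ^ (s.filter (fun i => f i < 0)).card * ∏ i ∈ s, f i := by
  induction s using Finset.induction_on with
  | empty => simp
  | insert b s hb ih =>
    have ih := ih fun i hi => hf i (Finset.mem_insert_of_mem hi)
    rw [Finset.prod_insert hb, Finset.filter_insert]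
    split_ifs with h
    · rw [Finset.card_insert_of_notMem (by simp [hb]), pow_succ]
      have := mul_pos ih (neg_pos.2 h)
      linarith
    · have h' : 0 < f b := lt_of_le_of_ne (not_lt.1 h) (hf b (Finset.mem_insert_self _ _)).symm
      have := mul_pos ih h'
      linarith

def altV {m : ℕ} (v : Fin m → ℝ) : Prop :=
  ∀ i : ℕ, ∀ h : i + 1 < m, 0 < (-1) ^ i * (v ⟨i + 1, h⟩ - v ⟨i, by omega⟩)

theorem IsCrit.deriv2_sign {m : ℕ} {a x : Fin m → ℝ} (h : IsCrit a x) (i : Fin m) :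
    0 < (-1) ^ (i : ℕ) * (derivative (derivative (polyOf a))).eval (x i) := by
  rw [h.deriv2]
  have h1 := prod_sign (Finset.univ.erase i) (fun j => x i - x j) (fun j hj => by
    rw [sub_ne_zero]; intro h'; simp at hj; exact hj (h.1.injective h').symm)
  have h2 : (Finset.univ.erase i).filter (fun j => x i - x j < 0) = Finset.Iio i := by
    ext j
    simp only [Finset.mem_filter, Finset.mem_erase, Finset.mem_univ, Finset.mem_Iio, sub_neg, h.1.lt_iff_gt]
    constructor
    · tauto
    · intro h; exact ⟨⟨h.ne, trivial⟩, h⟩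
  rw [h2, Fin.card_Iio] at h1
  have : (0 : ℝ) < m + 1 := by positivity
  have := mul_pos this h1
  linarith

theorem IsCrit.altV {m : ℕ} {a x : Fin m → ℝ} (h : IsCrit a x) : altV fun i => (polyOf a).eval (x i) := by
  intro i hi
  have hlt : x ⟨i + 1, hi⟩ < x ⟨i, by omega⟩ := h.1 (by simp [Fin.lt_def])
  have hmono : StrictMonoOn (fun t => (C ((-1) ^ (i + 1)) * polyOf a).eval t) (Set.Icc (x ⟨i + 1, hi⟩) (x ⟨i, by omega⟩)) := by
    refine strictMonoOn_of_deriv_pos (convex_Icc _ _) (Polynomial.continuous _).continuousOn fun t ht => ?_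
    rw [interior_Icc] at ht
    rw [Polynomial.deriv, derivative_C_mul, h.deriv_eq, eval_mul, eval_mul, eval_C, eval_C, eval_prod]
    simp only [eval_sub, eval_X, eval_C]
    have hor : ∀ j : Fin m, (j : ℕ) ≤ i ∧ t < x j ∨ ¬ (j : ℕ) ≤ i ∧ x j < t := by
      intro j
      by_cases hj : (j : ℕ) ≤ i
      · exact Or.inl ⟨hj, ht.2.trans_le (h.1.antitone (by simpa [Fin.le_def] using hj))⟩
      · exact Or.inr ⟨hj, ht.1.trans_le' (h.1.antitone (by simp only [Fin.le_def]; omega))⟩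
    have h1 := prod_sign Finset.univ (fun j => t - x j) (fun j _ => by
      rcases hor j with h | h
      · linarith [h.2]
      · linarith [h.2])
    have h2 : Finset.univ.filter (fun j => t - x j < 0) = Finset.Iic (⟨i, by omega⟩ : Fin m) := by
      ext j
      simp only [Finset.mem_filter, Finset.mem_univ, Finset.mem_Iic, sub_neg, true_and, Fin.le_def]
      constructor
      · intro hj
        rcases hor j with h | h
        · exact h.1
        · linarith [h.2]
      · intro hj
        rcases hor j with h | h
        · exact h.2
        · exact absurd hj h.1
    rw [h2, Fin.card_Iic] at h1
    simp only at h1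
    have : (0 : ℝ) < m + 1 := by positivity
    have := mul_pos this h1
    linarith
  have := hmono (Set.left_mem_Icc.2 hlt.le) (Set.right_mem_Icc.2 hlt.le) hlt
  simp only [eval_mul, eval_C, pow_succ] at this
  linarith

theorem IsCrit.root_iff {m : ℕ} {a x : Fin m → ℝ} (h : IsCrit a x) (t : ℝ) :
    (derivative (polyOf a)).eval t = 0 ↔ ∃ i, t = x i := by
  rw [h.deriv_eq, eval_mul, eval_C, eval_prod]
  have : (m : ℝ) + 1 ≠ 0 := by positivity
  simp [this, Finset.prod_eq_zero_iff, sub_eq_zero]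

theorem IsCrit.abs_le {m : ℕ} (hm : 0 < m) {a x : Fin m → ℝ} (h : IsCrit a x) {M : ℝ}
    (hM : ∀ i, |(polyOf a).eval (x i)| ≤ M) :
    ∀ t ∈ Set.Icc (x ⟨m - 1, by omega⟩) (x ⟨0, hm⟩), |(polyOf a).eval t| ≤ M := by
  set A := x ⟨m - 1, by omega⟩ with hA
  set B := x ⟨0, hm⟩ with hB
  have hAB : A ≤ B := h.1.antitone (by simp [Fin.le_def])
  have key : ∀ y ∈ Set.Icc A B, (IsLocalExtr (fun t => (polyOf a).eval t) y ∨ y = A ∨ y = B) → |(polyOf a).eval y| ≤ M := by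
    intro y hy hor
    rcases hor with h1 | h1 | h1
    · have := h1.deriv_eq_zero
      rw [Polynomial.deriv, h.root_iff] at this
      obtain ⟨i, rfl⟩ := this
      exact hM i
    · rw [h1]; exact hM _
    · rw [h1]; exact hM _
  have hor : ∀ y ∈ Set.Icc A B, (Set.Icc A B ∈ nhds y) ∨ y = A ∨ y = B := by
    intro y hy
    by_cases h1 : y = A; · tauto
    by_cases h2 : y = B; · tauto
    left
    exact Icc_mem_nhds (lt_of_le_of_ne hy.1 (Ne.symm h1)) (lt_of_le_of_ne hy.2 h2)
  have hc : ContinuousOn (fun t => (polyOf a).eval t) (Set.Icc A B) := (Polynomial.continuous _).continuousOn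
  obtain ⟨y, hy, hmax⟩ := isCompact_Icc.exists_isMaxOn ⟨A, Set.left_mem_Icc.2 hAB⟩ hc
  obtain ⟨z, hz, hmin⟩ := isCompact_Icc.exists_isMinOn ⟨A, Set.left_mem_Icc.2 hAB⟩ hc
  have h1 := key y hy (by
    rcases hor y hy with h | h
    · exact Or.inl (hmax.isLocalMax h).isExtr
    · exact Or.inr h)
  have h2 := key z hz (by
    rcases hor z hz with h | h
    · exact Or.inl (hmin.isLocalMin h).isExtr
    · exact Or.inr h)
  intro t ht
  have h3 := hmax ht
  have h4 := hmin ht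
  simp only [Set.mem_setOf_eq] at h3 h4
  rw [_root_.abs_le] at h1 h2 ⊢
  constructor <;> linarith

theorem IsCrit.bound {m : ℕ} (hm : 0 < m) {a x : Fin m → ℝ} (h : IsCrit a x) {M : ℝ} (hM0 : 0 < M)
    (hM : ∀ i, |(polyOf a).eval (x i)| ≤ M) (i : Fin m) : |x i| ≤ 2 * max 1 (2 ^ m * M) := by
  have hP := h.abs_le hm hM
  set A := x ⟨m - 1, by omega⟩ with hA
  set B := x ⟨0, hm⟩ with hB
  have hAi : ∀ i, A ≤ x i := fun i => h.1.antitone (by simp only [Fin.le_def]; omega)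
  have hBi : ∀ i, x i ≤ B := fun i => h.1.antitone (by simp [Fin.le_def])
  have hAB : A ≤ B := hAi _
  have hsum := h.sum_eq_zero hm
  have hA0 : A ≤ 0 := by
    by_contra hc
    push Not at hc
    have : 0 < ∑ i, x i := Finset.sum_pos (fun i _ => hc.trans_le (hAi i)) ⟨⟨0, hm⟩, Finset.mem_univ _⟩
    linarith
  have hB0 : 0 ≤ B := by
    by_contra hc
    push Not at hc
    have : ∑ i, x i < 0 := Finset.sum_neg (fun i _ => (hBi i).trans_lt hc) ⟨⟨0, hm⟩, Finset.mem_univ _⟩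
    linarith
  set r := (B - A) / 2 with hr
  have hr0 : 0 ≤ r := by rw [hr]; linarith
  have hrB : r ≤ max 1 (2 ^ m * M) := by
    by_cases hr1 : r ≤ 1
    · exact hr1.trans (le_max_left _ _)
    push Not at hr1
    refine le_trans ?_ (le_max_right _ _)
    have hlin : (C r * X + C ((A + B) / 2)).natDegree = 1 := natDegree_linear (by linarith)
    have hdeg : (C M⁻¹ * (polyOf a).comp (C r * X + C ((A + B) / 2))).natDegree = m + 1 := by
      rw [natDegree_C_mul (by positivity), natDegree_comp, polyOf_natDegree, hlin, mul_one]
    have := Polynomial.Chebyshev.coeff_le_of_forall_abs_le_one (n := m + 1)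
      (P := C M⁻¹ * (polyOf a).comp (C r * X + C ((A + B) / 2))) (by
        rw [← hdeg]; exact degree_le_natDegree) (by
        intro t ht
        rw [eval_mul, eval_C, eval_comp, abs_mul, abs_of_pos (by positivity), ← div_eq_inv_mul, div_le_one hM0]
        apply hP
        simp only [eval_add, eval_mul, eval_C, eval_X]
        rw [hr]
        constructor <;> nlinarith [ht.1, ht.2])
    have hco : (C M⁻¹ * (polyOf a).comp (C r * X + C ((A + B) / 2))).coeff (m + 1) = M⁻¹ * r ^ (m + 1) := by
      rw [coeff_C_mul]
      congr 1
      have h1 := leadingCoeff_comp (p := polyOf a) (q := C r * X + C ((A + B) / 2)) (by rw [hlin]; simp)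
      rw [leadingCoeff, natDegree_comp, polyOf_natDegree, hlin, mul_one, (polyOf_monic a).leadingCoeff,
        leadingCoeff_linear (by linarith)] at h1
      rw [h1, one_mul]
    rw [hco, ← div_eq_inv_mul, div_le_iff₀ hM0, Nat.add_sub_cancel] at this
    exact (le_self_pow₀ hr1.le (by omega)).trans this
  have := hAi i
  have := hBi i
  rw [_root_.abs_le]
  constructor <;> linarith

noncomputable def GG {m : ℕ} (z : (Fin m → ℝ) × (Fin m → ℝ)) : (Fin m → ℝ) × (Fin m → ℝ) :=
  (fun i => (polyOf z.1).eval (z.2 i), fun i => (derivative (polyOf z.1)).eval (z.2 i))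

theorem GG_contDiff {m : ℕ} : ContDiff ℝ 1 (GG (m := m)) := by
  unfold GG
  simp only [polyOf_eval, polyOf_deriv_eval]
  fun_prop

theorem polyOf_line {m : ℕ} (a b : Fin m → ℝ) (s : ℝ) :
    polyOf (a + s • b) = polyOf a + C s * ∑ k : Fin m, C (b k) * X ^ (k : ℕ) := by
  unfold polyOf
  simp only [Pi.add_apply, Pi.smul_apply, smul_eq_mul, map_add, map_mul, add_mul, Finset.sum_add_distrib,
    Finset.mul_sum, add_assoc, mul_assoc]

theorem line_deriv {m : ℕ} (Q S : ℝ[X]) (x y : ℝ) :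
    HasDerivAt (fun s : ℝ => (Q + C s * S).eval (x + s * y)) ((derivative Q).eval x * y + S.eval x) 0 := by
  simp only [eval_add, eval_mul, eval_C]
  have h0 : HasDerivAt (fun s : ℝ => x + s * y) y 0 := by
    simpa using ((hasDerivAt_id (0:ℝ)).mul_const y).const_add x
  have h1 := (Q.hasDerivAt (x + 0 * y)).comp (0:ℝ) h0
  have h2 := (hasDerivAt_id (0:ℝ)).mul ((S.hasDerivAt (x + 0 * y)).comp (0:ℝ) h0)
  refine (h1.add h2).congr_deriv ?_
  simp

theorem GG_fderiv_inj {m : ℕ} {z : (Fin m → ℝ) × (Fin m → ℝ)} (hz : IsCrit z.1 z.2) :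
    Function.Injective (fderiv ℝ GG z) := by
  rw [injective_iff_map_eq_zero]
  rintro ⟨b, y⟩ h
  have hd : HasFDerivAt GG (fderiv ℝ GG z) z := (GG_contDiff.differentiable (by norm_num) z).hasFDerivAt
  have hl : HasDerivAt (fun s : ℝ => z + s • (b, y)) (b, y) 0 := by
    simpa using ((hasDerivAt_id (0:ℝ)).smul_const (b, y)).const_add z
  have hc : HasDerivAt (fun s : ℝ => GG (z + s • (b, y))) (fderiv ℝ GG z (b, y)) 0 := by
    have hd' : HasFDerivAt GG (fderiv ℝ GG z) (z + (0:ℝ) • (b, y)) := by simpa using hd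
    exact hd'.comp_hasDerivAt (0:ℝ) hl
  rw [h] at hc
  have hb : b = 0 := by
    apply Matrix.eq_zero_of_forall_index_sum_pow_mul_eq_zero hz.1.injective
    intro i
    have h1 : HasDerivAt (fun s : ℝ => (GG (z + s • (b, y))).1 i) 0 0 := by
      have := (hasDerivAt_pi.1 ((ContinuousLinearMap.fst ℝ (Fin m → ℝ) (Fin m → ℝ)).hasFDerivAt.comp_hasDerivAt (0:ℝ) hc)) i
      simpa using this
    have h2 := line_deriv (m := m) (polyOf z.1) (∑ k : Fin m, C (b k) * X ^ (k : ℕ)) (z.2 i) (y i)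
    have e : (fun s : ℝ => (GG (z + s • (b, y))).1 i) = (fun s : ℝ => (polyOf z.1 + C s * ∑ k : Fin m, C (b k) * X ^ (k : ℕ)).eval (z.2 i + s * y i)) := by
      funext s
      rw [← polyOf_line]; rfl
    rw [e] at h1
    have h3 := h1.unique h2
    rw [hz.2 i] at h3
    simp [eval_finsetSum] at h3
    rw [h3]
    exact Finset.sum_congr rfl fun k _ => mul_comm _ _
  subst hb
  have hy : y = 0 := by
    funext i
    have h1 : HasDerivAt (fun s : ℝ => (GG (z + s • ((0 : Fin m → ℝ), y))).2 i) 0 0 := by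
      have := (hasDerivAt_pi.1 ((ContinuousLinearMap.snd ℝ (Fin m → ℝ) (Fin m → ℝ)).hasFDerivAt.comp_hasDerivAt (0:ℝ) hc)) i
      simpa using this
    have h2 := line_deriv (m := m) (derivative (polyOf z.1)) 0 (z.2 i) (y i)
    have e : (fun s : ℝ => (GG (z + s • ((0 : Fin m → ℝ), y))).2 i) = (fun s : ℝ => (derivative (polyOf z.1) + C s * 0).eval (z.2 i + s * y i)) := by
      funext s
      simp [GG]
    rw [e] at h1
    have h3 := h1.unique h2
    simp at h3
    rcases h3 with h3 | h3
    · exact absurd h3 (hz.deriv2_ne i)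
    · exact h3
  subst hy
  rfl

theorem GG_strict {m : ℕ} {z : (Fin m → ℝ) × (Fin m → ℝ)} (hz : IsCrit z.1 z.2) :
    ∃ e : ((Fin m → ℝ) × (Fin m → ℝ)) ≃L[ℝ] ((Fin m → ℝ) × (Fin m → ℝ)),
      HasStrictFDerivAt GG (e : _ →L[ℝ] _) z := by
  let e := (LinearEquiv.ofInjectiveEndo (fderiv ℝ GG z).toLinearMap (GG_fderiv_inj hz)).toContinuousLinearEquiv
  refine ⟨e, ?_⟩
  have : (e : _ →L[ℝ] _) = fderiv ℝ GG z := by ext <;> rfl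
  rw [this]
  exact (GG_contDiff.contDiffAt).hasStrictFDerivAt (by norm_num)

theorem isOpen_strictAnti {m : ℕ} : IsOpen {x : Fin m → ℝ | StrictAnti x} := by
  have : {x : Fin m → ℝ | StrictAnti x} = ⋂ i : Fin m, ⋂ j : Fin m, {x | i < j → x j < x i} := by
    ext x; simp [StrictAnti]
  rw [this]
  refine isOpen_iInter_of_finite fun i => isOpen_iInter_of_finite fun j => ?_
  by_cases h : i < j
  · simp only [h, true_imp_iff]
    exact isOpen_lt (continuous_apply j) (continuous_apply i)
  · simp [h]

abbrev ZZ (m : ℕ) := {z : (Fin m → ℝ) × (Fin m → ℝ) // IsCrit z.1 z.2}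
abbrev VV (m : ℕ) := {v : Fin m → ℝ // altV v}

noncomputable def piV {m : ℕ} (z : ZZ m) : VV m := ⟨fun i => (polyOf z.1.1).eval (z.1.2 i), z.2.altV⟩

theorem GG_Z {m : ℕ} (z : ZZ m) : GG z.1 = ((piV z).1, 0) := by
  ext i
  · rfl
  · exact z.2.2 i

theorem piV_continuous {m : ℕ} : Continuous (piV (m := m)) := by
  refine Continuous.subtype_mk ?_ _
  have : Continuous fun z : ZZ m => (GG z.1).1 :=
    continuous_fst.comp (GG_contDiff.continuous.comp continuous_subtype_val)
  exact this

theorem piV_localHomeo {m : ℕ} : IsLocalHomeomorph (piV (m := m)) := by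
  apply isLocalHomeomorph_of_open_locInj _ piV_continuous
  · rw [isOpenMap_iff_nhds_le]
    intro z S hS
    obtain ⟨e, he⟩ := GG_strict z.2
    have hmap := he.map_nhds_eq_of_equiv
    rw [Filter.mem_map, nhds_subtype_eq_comap, Filter.mem_comap] at hS
    obtain ⟨T, hT, hTS⟩ := hS
    have hT2 : T ∩ {y | StrictAnti y.2} ∈ nhds z.1 :=
      Filter.inter_mem hT ((isOpen_strictAnti.preimage continuous_snd).mem_nhds z.2.1)
    have h1 := Filter.image_mem_map (m := GG) hT2
    rw [hmap, GG_Z] at h1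
    have h2 : Filter.Tendsto (fun v : VV m => ((v.1, 0) : (Fin m → ℝ) × (Fin m → ℝ))) (nhds (piV z)) (nhds ((piV z).1, 0)) := by
      apply Continuous.tendsto (f := fun v : VV m => ((v.1, 0) : (Fin m → ℝ) × (Fin m → ℝ)))
      fun_prop
    filter_upwards [h2 h1] with v hv
    obtain ⟨y, ⟨hy1, hy2⟩, hy3⟩ := hv
    have hyc : IsCrit y.1 y.2 := ⟨hy2, fun i => congrFun (congrArg Prod.snd hy3) i⟩
    have : (⟨y, hyc⟩ : ZZ m) ∈ piV ⁻¹' S := hTS hy1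
    have hv : piV ⟨y, hyc⟩ = v := Subtype.ext (congrArg Prod.fst hy3)
    rw [← hv]; exact this
  · intro z
    obtain ⟨e, he⟩ := GG_strict z.2
    let f := he.toOpenPartialHomeomorph GG
    refine ⟨Subtype.val ⁻¹' f.source, ?_, ?_⟩
    · exact (f.open_source.preimage continuous_subtype_val).mem_nhds he.mem_toOpenPartialHomeomorph_source
    · intro p hp q hq hpq
      apply Subtype.ext
      apply f.injOn hp hq
      change GG p.1 = GG q.1
      rw [GG_Z, GG_Z, hpq]

theorem eval_antiC {m : ℕ} (hm : 0 < m) (x : Fin m → ℝ) (c t : ℝ) :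
    (polyOf (antiC x c)).eval t = (polyOf (antiC x 0)).eval t + c := by
  rw [polyOf_eval, polyOf_eval]
  rw [← Finset.add_sum_erase _ _ (Finset.mem_univ (⟨0, hm⟩ : Fin m)),
    ← Finset.add_sum_erase (a := (⟨0, hm⟩ : Fin m)) _ (fun k => antiC x 0 k * t ^ (k : ℕ)) (Finset.mem_univ _)]
  have : ∀ k ∈ Finset.univ.erase (⟨0, hm⟩ : Fin m), antiC x c k * t ^ (k : ℕ) = antiC x 0 k * t ^ (k : ℕ) := by
    intro k hk
    have : (k : ℕ) ≠ 0 := by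
      intro h; simp at hk; exact hk (Fin.ext h)
    simp [antiC, this]
  rw [Finset.sum_congr rfl this]
  simp [antiC]
  ring

theorem isClosed_antitone' {m : ℕ} : IsClosed {x : Fin m → ℝ | Antitone x} := by
  have : {x : Fin m → ℝ | Antitone x} = ⋂ i : Fin m, ⋂ j : Fin m, {x | i ≤ j → x j ≤ x i} := by
    ext x; simp [Antitone]
  rw [this]
  refine isClosed_iInter fun i => isClosed_iInter fun j => ?_
  by_cases h : i ≤ j
  · simp only [h, true_imp_iff]
    exact isClosed_le (continuous_apply j) (continuous_apply i)
  · simp [h]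

theorem strictAnti_of_altV {m : ℕ} {x : Fin m → ℝ} (hx : Antitone x) (f : ℝ → ℝ) (h : altV fun i => f (x i)) :
    StrictAnti x := by
  intro i j hij
  refine lt_of_le_of_ne (hx hij.le) fun he => ?_
  have hij' : (i : ℕ) < j := hij
  have h1 : (i : ℕ) + 1 < m := by omega
  have h2 := h i h1
  have h3 : x ⟨i + 1, h1⟩ = x i := by
    apply le_antisymm
    · exact hx (Fin.le_def.2 (by simp))
    · rw [← he]
      exact hx (Fin.le_def.2 (by simp; omega))
  simp [h3] at h2

theorem continuous_evalP {m : ℕ} {Y : Type*} [TopologicalSpace Y] (f : Y → Fin m → ℝ) (g : Y → ℝ)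
    (hf : Continuous f) (hg : Continuous g) : Continuous fun p => (polyOf (f p)).eval (g p) := by
  simp only [polyOf_eval]
  fun_prop

theorem continuous_antiC2 {m : ℕ} {Y : Type*} [TopologicalSpace Y] (f : Y → Fin m → ℝ) (g : Y → ℝ)
    (hf : Continuous f) (hg : Continuous g) : Continuous fun p => antiC (f p) (g p) :=
  Continuous.comp (g := fun p : (Fin m → ℝ) × ℝ => antiC p.1 p.2) (f := fun y => (f y, g y))
    continuous_antiC (hf.prodMk hg)

theorem piV_proper {m : ℕ} (hm : 0 < m) : IsProperMap (piV (m := m)) := by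
  have hVo : IsOpen {v : Fin m → ℝ | altV v} := by
    have : {v : Fin m → ℝ | altV v} = ⋂ i : Fin m, {v | ∀ h : (i:ℕ) + 1 < m, 0 < (-1) ^ (i:ℕ) * (v ⟨i + 1, h⟩ - v i)} := by
      ext v
      simp only [altV, Set.mem_iInter, Set.mem_ofPred_eq]
      exact ⟨fun h i hi => h i hi, fun h i hi => h ⟨i, by omega⟩ hi⟩
    rw [this]
    refine isOpen_iInter_of_finite fun i => ?_
    by_cases h : (i:ℕ) + 1 < m
    · simp only [h, forall_true_left]
      exact isOpen_lt (by fun_prop) (by fun_prop)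
    · simp [h]
  have : LocallyCompactSpace (VV m) := hVo.locallyCompactSpace
  rw [isProperMap_iff_isCompact_preimage]
  refine ⟨piV_continuous, fun K hK => ?_⟩
  rw [Topology.IsEmbedding.subtypeVal.isCompact_iff]
  set K' : Set (Fin m → ℝ) := Subtype.val '' K with hK'
  have hKc : IsCompact K' := hK.image continuous_subtype_val
  have himg : (Subtype.val '' (piV ⁻¹' K) : Set ((Fin m → ℝ) × (Fin m → ℝ)))
      = {z | Antitone z.2} ∩ ({z | (GG z).2 = 0} ∩ {z | (GG z).1 ∈ K'}) := by
    ext z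
    constructor
    · rintro ⟨y, hy, rfl⟩
      exact ⟨y.2.1.antitone, by simp [GG_Z], ⟨piV y, hy, by simp [GG_Z]⟩⟩
    · rintro ⟨h1, h2, ⟨v, hv, hvz⟩⟩
      have hs : StrictAnti z.2 := by
        apply strictAnti_of_altV h1 (fun t => (polyOf z.1).eval t)
        have := v.2
        rw [hvz] at this
        exact this
      have hz : IsCrit z.1 z.2 := ⟨hs, fun i => congrFun h2 i⟩
      refine ⟨⟨z, hz⟩, ?_, rfl⟩
      have : piV ⟨z, hz⟩ = v := Subtype.ext hvz.symm
      rw [Set.mem_preimage, this]; exact hv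
  have hGc := (GG_contDiff (m := m)).continuous
  have hclosed : IsClosed (Subtype.val '' (piV ⁻¹' K) : Set ((Fin m → ℝ) × (Fin m → ℝ))) := by
    rw [himg]
    refine (isClosed_antitone'.preimage continuous_snd).inter (IsClosed.inter ?_ ?_)
    · exact isClosed_eq (continuous_snd.comp hGc) continuous_const
    · exact hKc.isClosed.preimage (continuous_fst.comp hGc)
  obtain ⟨M, hM⟩ := hKc.isBounded.exists_norm_le
  set R := 2 * max 1 (2 ^ m * max 1 M)
  let φ : (Fin m → ℝ) × (Fin m → ℝ) → (Fin m → ℝ) × (Fin m → ℝ) :=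
    fun p => (antiC p.1 (p.2 ⟨0, hm⟩ - (polyOf (antiC p.1 0)).eval (p.1 ⟨0, hm⟩)), p.1)
  have hφ : Continuous φ := by
    have h0 : Continuous fun p : (Fin m → ℝ) × (Fin m → ℝ) => antiC p.1 0 :=
      continuous_antiC2 _ _ continuous_fst continuous_const
    have h1 : Continuous fun p : (Fin m → ℝ) × (Fin m → ℝ) => (polyOf (antiC p.1 0)).eval (p.1 ⟨0, hm⟩) :=
      continuous_evalP _ _ h0 ((continuous_apply _).comp continuous_fst)
    refine Continuous.prodMk ?_ continuous_fst
    exact continuous_antiC2 _ _ continuous_fst (((continuous_apply _).comp continuous_snd).sub h1)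
  refine IsCompact.of_isClosed_subset (((isCompact_closedBall (0 : Fin m → ℝ) R).prod hKc).image hφ) hclosed ?_
  rintro _ ⟨z, hz, rfl⟩
  have hzK : (piV z).1 ∈ K' := ⟨_, hz, rfl⟩
  refine ⟨(z.1.2, (piV z).1), ⟨?_, hzK⟩, ?_⟩
  · rw [mem_closedBall_zero_iff]
    rw [pi_norm_le_iff_of_nonneg (by positivity)]
    intro i
    refine z.2.bound hm (by positivity) (fun j => ?_) i
    exact ((norm_le_pi_norm _ j).trans (hM _ hzK)).trans (le_max_right _ _)
  · have h1 := z.2.eq_antiC hm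
    have h2 : (piV z).1 ⟨0, hm⟩ = (polyOf (antiC z.1.2 0)).eval (z.1.2 ⟨0, hm⟩) + z.1.1 ⟨0, hm⟩ := by
      rw [← eval_antiC hm, ← h1]; rfl
    refine Prod.ext ?_ rfl
    change antiC z.1.2 ((piV z).1 ⟨0, hm⟩ - _) = _
    rw [h2, add_sub_cancel_left]
    exact h1.symm

theorem ZZ_pathConnected {m : ℕ} (hm : 0 < m) : PathConnectedSpace (ZZ m) := by
  let S : Set ((Fin m → ℝ) × ℝ) := {p | StrictAnti p.1 ∧ ∑ i, p.1 i = 0}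
  have hconv : Convex ℝ S := by
    rintro ⟨x, c⟩ ⟨hx1, hx2⟩ ⟨y, d⟩ ⟨hy1, hy2⟩ s t hs ht hst
    refine ⟨?_, ?_⟩
    · intro i j hij
      simp only [Prod.smul_mk, Prod.mk_add_mk, Pi.add_apply, Pi.smul_apply, smul_eq_mul]
      have h1 := hx1 hij
      have h2 := hy1 hij
      simp only at h1 h2
      rcases hs.eq_or_lt with rfl | hs
      · have : t = 1 := by linarith
        subst this; linarith
      · nlinarith
    · simp only at hx2 hy2
      simp [Finset.sum_add_distrib, ← Finset.mul_sum, hx2, hy2]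
  have hne : S.Nonempty := by
    refine ⟨(fun i => ((m:ℝ) - 1) / 2 - i, 0), ?_, ?_⟩
    · intro i j hij
      have : ((i:ℕ):ℝ) < (j:ℕ) := by exact_mod_cast hij
      simp only; linarith
    · simp only [Finset.sum_sub_distrib, Finset.sum_const, Finset.card_univ, Fintype.card_fin, nsmul_eq_mul]
      rw [Fin.sum_univ_eq_sum_range (fun i => (i:ℝ))]
      have := Finset.sum_range_id_mul_two m
      have h2 : ((∑ i ∈ Finset.range m, i : ℕ) : ℝ) * 2 = m * (m - 1) := by
        have h3 : ((m - 1 : ℕ) : ℝ) = m - 1 := by rw [Nat.cast_sub (by omega)]; simp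
        rw [← h3]; exact_mod_cast this
      push_cast at h2
      linarith
  have hpc : PathConnectedSpace S := isPathConnected_iff_pathConnectedSpace.1 (hconv.isPathConnected hne)
  let f : S → ZZ m := fun p => ⟨(antiC p.1.1 p.1.2, p.1.1), isCrit_antiC hm p.2.1 p.2.2 _⟩
  have hf : Continuous f := by
    refine Continuous.subtype_mk ?_ _
    exact (continuous_antiC.comp continuous_subtype_val).prodMk (continuous_fst.comp continuous_subtype_val)
  refine Function.Surjective.pathConnectedSpace (f := f) ?_ hf
  intro z
  refine ⟨⟨(z.1.2, z.1.1 ⟨0, hm⟩), z.2.1, z.2.sum_eq_zero hm⟩, ?_⟩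
  refine Subtype.ext (Prod.ext ?_ rfl)
  exact (z.2.eq_antiC hm).symm

theorem VV_simplyConnected {m : ℕ} (hm : 0 < m) : SimplyConnectedSpace (VV m) := by
  have hconv : Convex ℝ {v : Fin m → ℝ | altV v} := by
    intro x hx y hy s t hs ht hst i hi
    have h1 := hx i hi
    have h2 := hy i hi
    simp only [Pi.add_apply, Pi.smul_apply, smul_eq_mul]
    rcases hs.eq_or_lt with rfl | hs
    · have : t = 1 := by linarith
      subst this; linarith
    · have := mul_pos hs h1
      have := mul_nonneg ht h2.le
      linarith
  have hne : {v : Fin m → ℝ | altV v}.Nonempty := by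
    have := ZZ_pathConnected hm
    obtain ⟨z⟩ := (inferInstance : Nonempty (ZZ m))
    exact ⟨_, (piV z).2⟩
  have : ContractibleSpace (VV m) := hconv.contractibleSpace hne
  infer_instance

theorem davis {m : ℕ} (hm : 0 < m) : Function.Bijective (piV (m := m)) := by
  have := ZZ_pathConnected hm
  have := VV_simplyConnected hm
  exact bij_of_proper_localHomeo _ piV_localHomeo (piV_proper hm)

theorem eval_pos_of_no_roots (q : ℝ[X]) (hq : q.Monic) (hr : ∀ t, q.eval t ≠ 0) (c : ℝ) : 0 < q.eval c := by
  by_contra hc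
  have hc' : q.eval c < 0 := lt_of_le_of_ne (not_lt.1 hc) (hr c)
  by_cases hd : q.natDegree = 0
  · rw [hq.natDegree_eq_zero] at hd
    subst hd
    simp at hc'
    linarith
  · have ht := q.tendsto_atTop_of_leadingCoeff_nonneg (natDegree_pos_iff_degree_pos.1 (by omega))
      (by rw [hq.leadingCoeff]; norm_num)
    obtain ⟨t, ht1, ht2⟩ := ((ht.eventually_gt_atTop 0).and (Filter.eventually_ge_atTop c)).exists
    obtain ⟨s, _, hs⟩ := intermediate_value_Icc ht2 q.continuous.continuousOn ⟨hc'.le, ht1.le⟩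
    exact hr s hs

theorem multiset_prod_sign (c : ℝ) (s : Multiset ℝ) (hs : ∀ r ∈ s, r ≠ c) :
    0 < (-1) ^ (s.countP (fun r => c < r)) * (s.map (fun r => c - r)).prod := by
  induction s using Multiset.induction_on with
  | empty => simp
  | cons r s ih =>
    have ih := ih fun i hi => hs i (Multiset.mem_cons_of_mem hi)
    rw [Multiset.map_cons, Multiset.prod_cons]
    by_cases h : c < r
    · rw [Multiset.countP_cons_of_pos (p := fun r => c < r) s h, pow_succ]
      have := mul_pos ih (sub_pos.2 h)
      linarith
    · rw [Multiset.countP_cons_of_neg (p := fun r => c < r) s h]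
      have h' : r < c := lt_of_le_of_ne (not_lt.1 h) (hs r (Multiset.mem_cons_self _ _))
      have := mul_pos ih (sub_pos.2 h')
      linarith

theorem eval_sign (Q : ℝ[X]) (hQ : Q.Monic) (c : ℝ) (hc : Q.eval c ≠ 0) :
    0 < (-1) ^ (Q.roots.countP (fun r => c < r)) * Q.eval c := by
  obtain ⟨q, hq, -, hq0⟩ := Q.exists_prod_multiset_X_sub_C_mul
  have hmon : (Q.roots.map fun a => X - C a).prod.Monic := monic_multisetProd_X_sub_C _
  have hqm : q.Monic := by
    apply hmon.of_mul_monic_left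
    rw [hq]; exact hQ
  have hqp := eval_pos_of_no_roots q hqm (fun t ht => by
    have : t ∈ q.roots := (mem_roots hqm.ne_zero).2 ht
    rw [hq0] at this; simp at this) c
  have h1 := multiset_prod_sign c Q.roots (fun r hr h => hc (by
    rw [← h]; exact (mem_roots hQ.ne_zero).1 hr))
  have h2 : Q.eval c = (Q.roots.map (fun r => c - r)).prod * q.eval c := by
    conv_lhs => rw [← hq]
    rw [eval_mul, eval_multiset_prod, Multiset.map_map]
    simp
  rw [h2, ← mul_assoc]
  exact mul_pos h1 hqp

theorem sub_C_monic {m : ℕ} (a : Fin m → ℝ) (c : ℝ) : (polyOf a - C c).Monic := by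
  apply (polyOf_monic a).sub_of_left
  rw [degree_eq_natDegree (polyOf_monic a).ne_zero, polyOf_natDegree]
  exact lt_of_le_of_lt degree_C_le (by exact_mod_cast Nat.succ_pos m)

/-- multiplicity at a critical point -/
theorem IsCrit.mult_crit {m : ℕ} {a x : Fin m → ℝ} (h : IsCrit a x) (i : Fin m) :
    (polyOf a - C ((polyOf a).eval (x i))).rootMultiplicity (x i) = 2 := by
  have h0 := (sub_C_monic a ((polyOf a).eval (x i))).ne_zero
  apply le_antisymm
  · by_contra hc
    push Not at hc
    have := (lt_rootMultiplicity_iff_isRoot_iterate_derivative h0).1 hc 2 le_rfl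
    apply h.deriv2_ne i
    simpa using this
  · refine Nat.succ_le_of_lt ?_
    refine (one_lt_rootMultiplicity_iff_isRoot h0).2 ⟨?_, ?_⟩
    · simp
    · simpa using h.2 i

theorem IsCrit.mult_noncrit {m : ℕ} {a x : Fin m → ℝ} (h : IsCrit a x) (t : ℝ) (ht : ∀ i, t ≠ x i) :
    (polyOf a - C ((polyOf a).eval t)).rootMultiplicity t = 1 := by
  have h0 := (sub_C_monic a ((polyOf a).eval t)).ne_zero
  apply le_antisymm
  · by_contra hc
    push Not at hc
    have := ((one_lt_rootMultiplicity_iff_isRoot h0).1 hc).2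
    simp only [derivative_sub, derivative_C, sub_zero, IsRoot.def] at this
    obtain ⟨i, hi⟩ := (h.root_iff t).1 this
    exact ht i hi
  · exact (rootMultiplicity_pos h0).2 (by simp)

noncomputable def BB {m : ℕ} (a x : Fin m → ℝ) (i : Fin m) : Finset ℝ :=
  (polyOf a - C ((polyOf a).eval (x i))).roots.toFinset.filter (fun b => x i < b)

theorem mem_BB {m : ℕ} {a x : Fin m → ℝ} {i : Fin m} {b : ℝ} :
    b ∈ BB a x i ↔ (polyOf a).eval b = (polyOf a).eval (x i) ∧ x i < b := by
  unfold BB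
  rw [Finset.mem_filter, Multiset.mem_toFinset, mem_roots (sub_C_monic _ _).ne_zero]
  simp [sub_eq_zero]

theorem BB_card {m : ℕ} {a x : Fin m → ℝ} (h : IsCrit a x)
    (hv : Function.Injective fun i => (polyOf a).eval (x i)) (i : Fin m) :
    ((-1) ^ (BB a x i).card : ℤ) = (-1) ^ (i : ℕ) := by
  set R := polyOf a - C ((polyOf a).eval (x i)) with hR
  have hRm : R.Monic := sub_C_monic _ _
  have hmul := h.mult_crit i
  obtain ⟨Q, hQ⟩ := pow_rootMultiplicity_dvd R (x i)
  rw [hmul] at hQ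
  have hXm : ((X - C (x i)) ^ 2).Monic := (monic_X_sub_C _).pow 2
  have hQm : Q.Monic := hXm.of_mul_monic_left (hQ ▸ hRm)
  have h2 : (derivative (derivative (polyOf a))).eval (x i) = 2 * Q.eval (x i) := by
    have : derivative (derivative (polyOf a)) = derivative (derivative R) := by simp [hR]
    rw [this, hQ]
    simp [derivative_mul, derivative_pow]
  have hs := h.deriv2_sign i
  rw [h2] at hs
  have hQ0 : Q.eval (x i) ≠ 0 := by
    intro h0; rw [h0] at hs; simp at hs
  have hs2 := eval_sign Q hQm (x i) hQ0
  have hc : Q.roots.countP (fun r => x i < r) = (BB a x i).card := by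
    have hroots : R.roots = 2 • {x i} + Q.roots := by
      rw [hQ, roots_mul (mul_ne_zero hXm.ne_zero hQm.ne_zero), roots_pow, roots_X_sub_C]
    have e1 : Q.roots.countP (fun r => x i < r) = R.roots.countP (fun r => x i < r) := by
      rw [hroots, Multiset.countP_add, Multiset.countP_nsmul]
      have : Multiset.countP (fun r => x i < r) {x i} = 0 := by
        rw [Multiset.countP_eq_zero]; simp
      rw [this]; simp
    rw [e1, Multiset.countP_eq_card_filter]
    have hnd : (R.roots.filter (fun r => x i < r)).Nodup := by
      rw [Multiset.nodup_iff_count_le_one]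
      intro b
      rw [Multiset.count_filter]
      split_ifs with hb
      · rw [count_roots]
        by_cases hbr : R.eval b = 0
        · have hbr' : (polyOf a).eval (x i) = (polyOf a).eval b := by
            simp [hR, sub_eq_zero] at hbr; exact hbr.symm
          rw [hR, hbr']
          refine (h.mult_noncrit b fun k hk => ?_).le
          have hik : i = k := hv (by simp only [hbr', hk])
          rw [hk, hik] at hb; exact lt_irrefl _ hb
        · rw [rootMultiplicity_eq_zero hbr]; simp
      · simp
    unfold BB
    rw [← Multiset.toFinset_filter, Multiset.toFinset_card_of_nodup hnd]
  rw [hc] at hs2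
  have hprod := mul_pos hs hs2
  rcases neg_one_pow_eq_or ℝ (BB a x i).card with h3 | h3 <;> rcases neg_one_pow_eq_or ℝ (i : ℕ) with h4 | h4
  · have : ((-1 : ℤ) ^ (BB a x i).card : ℝ) = ((-1 : ℤ) ^ (i:ℕ) : ℝ) := by push_cast; rw [h3, h4]
    exact_mod_cast this
  · rw [h3, h4] at hprod; nlinarith [sq_nonneg (Q.eval (x i))]
  · rw [h3, h4] at hprod; nlinarith [sq_nonneg (Q.eval (x i))]
  · have : ((-1 : ℤ) ^ (BB a x i).card : ℝ) = ((-1 : ℤ) ^ (i:ℕ) : ℝ) := by push_cast; rw [h3, h4]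
    exact_mod_cast this

theorem prod_neg_one (m : ℕ) : ∏ i ∈ Finset.range m, (-1 : ℤ) ^ i = (-1) ^ (m / 2) := by
  induction m with
  | zero => simp
  | succ m ih =>
    rw [Finset.prod_range_succ, ih, ← pow_add]
    rcases Nat.even_or_odd' m with ⟨k, rfl | rfl⟩
    · have h1 : 2 * k / 2 = k := by omega
      have h2 : (2 * k + 1) / 2 = k := by omega
      rw [h1, h2, pow_add, pow_mul]; simp
    · have h1 : (2 * k + 1) / 2 = k := by omega
      have h2 : (2 * k + 1 + 1) / 2 = k + 1 := by omega
      rw [h1, h2, pow_add, pow_add, pow_mul]; simp [pow_succ]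

theorem epsilon_eq {m : ℕ} {a x : Fin m → ℝ} (h : IsCrit a x)
    (hv : Function.Injective fun i => (polyOf a).eval (x i)) :
    epsilonP (polyOf a) = (-1) ^ (m / 2) := by
  let D : Finset (Σ _ : Fin m, ℝ) := Finset.univ.sigma (fun i => BB a x i)
  let f : (Σ _ : Fin m, ℝ) → ℝ × ℝ := fun p => (x p.1, p.2)
  have hf : Function.Injective f := by
    rintro ⟨i, b⟩ ⟨j, c⟩ hij
    simp only [f, Prod.mk.injEq] at hij
    obtain ⟨h1, rfl⟩ := hij
    rw [h.1.injective h1]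
  have hD : disorders (polyOf a) = ↑(D.image f) := by
    ext ⟨s, t⟩
    simp only [disorders, Set.mem_ofPred_eq, Finset.coe_image, Set.mem_image, Finset.mem_coe, D, Finset.mem_sigma,
      Finset.mem_univ, true_and, mem_BB]
    constructor
    · rintro ⟨h1, h2, h3⟩
      by_cases hs : ∃ i, s = x i
      · obtain ⟨i, rfl⟩ := hs
        exact ⟨⟨i, t⟩, ⟨h2.symm, h1⟩, rfl⟩
      · push Not at hs
        rw [h.mult_noncrit s hs] at h3
        have := (rootMultiplicity_pos (sub_C_monic a ((polyOf a).eval t)).ne_zero (x := t)).2 (by simp)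
        omega
    · rintro ⟨⟨i, b⟩, ⟨h1, h2⟩, h3⟩
      simp only [f, Prod.mk.injEq] at h3
      obtain ⟨rfl, rfl⟩ := h3
      refine ⟨h2, h1.symm, ?_⟩
      rw [h.mult_crit i, h.mult_noncrit]
      · norm_num
      · intro k hk
        subst hk
        have : k = i := hv h1
        rw [this] at h2; exact lt_irrefl _ h2
  unfold epsilonP
  rw [hD]
  rw [Nat.card_coe_set_eq, Set.ncard_coe_finset, Finset.card_image_of_injective _ hf, Finset.card_sigma,
    ← Finset.prod_pow_eq_pow_sum, Finset.prod_congr rfl fun i _ => BB_card h hv i,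
    Fin.prod_univ_eq_prod_range (fun i => (-1 : ℤ) ^ i), prod_neg_one]

theorem map_sub_eq (P : ℝ[X]) (w : ℝ) :
    P.map (algebraMap ℝ ℂ) - C (w : ℂ) = (P - C w).map (algebraMap ℝ ℂ) := by
  simp

theorem real_double {m : ℕ} {a : Fin m → ℝ} {w : ℝ} (h : ramType (polyOf a) w = 2 ::ₘ Multiset.replicate (m - 1) 1) :
    ∃ y : ℝ, (polyOf a).eval y = w ∧ (derivative (polyOf a)).eval y = 0 := by
  unfold ramType at h
  rw [map_sub_eq] at h
  set R := polyOf a - C w with hR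
  have hRm : R.Monic := sub_C_monic a w
  set Q := R.map (algebraMap ℝ ℂ) with hQ
  have hQm : Q.Monic := hRm.map _
  have hcount : (Q.roots.toFinset.filter (fun z => 2 = Q.rootMultiplicity z)).card = 1 := by
    have := congrArg (Multiset.count 2) h
    rw [Multiset.count_map] at this
    rw [Finset.card_def, Finset.filter_val, this]
    simp [Multiset.count_replicate]
  obtain ⟨z, hz⟩ := Finset.card_eq_one.1 hcount
  have hz1 : z ∈ Q.roots.toFinset.filter (fun z => 2 = Q.rootMultiplicity z) := by rw [hz]; simp
  have hconj : Q.map (starRingEnd ℂ) = Q := by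
    rw [hQ, Polynomial.map_map]
    congr 1
    ext r
    simp
  have hzm : 2 = Q.rootMultiplicity z := (Finset.mem_filter.1 hz1).2
  have hcm : 2 = Q.rootMultiplicity (starRingEnd ℂ z) := by
    have := eq_rootMultiplicity_map (p := Q) (f := starRingEnd ℂ) (RingHom.injective _) z
    rw [hconj] at this
    rw [← this]; exact hzm
  have hz2 : starRingEnd ℂ z ∈ Q.roots.toFinset.filter (fun z => 2 = Q.rootMultiplicity z) := by
    rw [Finset.mem_filter, Multiset.mem_toFinset, mem_roots hQm.ne_zero]
    refine ⟨?_, hcm⟩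
    exact (rootMultiplicity_pos hQm.ne_zero).1 (by omega)
  rw [hz, Finset.mem_singleton] at hz2
  obtain ⟨y, hy⟩ := Complex.conj_eq_iff_real.1 hz2
  have hy2 : R.rootMultiplicity y = 2 := by
    rw [eq_rootMultiplicity_map (f := algebraMap ℝ ℂ) (RingHom.injective _) y, hzm, hy]; rfl
  have := (one_lt_rootMultiplicity_iff_isRoot hRm.ne_zero).1 (by omega : 1 < R.rootMultiplicity y)
  refine ⟨y, ?_, ?_⟩
  · have := this.1
    simpa [hR, sub_eq_zero] using this
  · have := this.2
    simpa [hR] using this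

theorem crit_of_simple {m : ℕ} {a : Fin m → ℝ} {w : Fin m → ℝ} (hw : Function.Injective w)
    (h : ∀ j, ramType (polyOf a) (w j) = 2 ::ₘ Multiset.replicate (m - 1) 1) :
    ∃ x, IsCrit a x ∧ Set.range (fun i => (polyOf a).eval (x i)) = Set.range w := by
  choose y hy1 hy2 using fun j => real_double (h j)
  have hyi : Function.Injective y := fun i j hij => hw (by rw [← hy1, ← hy1, hij])
  let s : Finset ℝ := Finset.univ.image y
  have hs : s.card = m := by rw [Finset.card_image_of_injective _ hyi]; simp
  let x : Fin m → ℝ := fun i => s.orderEmbOfFin hs (Fin.rev i)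
  have hrange : Set.range x = Set.range y := by
    have h1 : Set.range x = Set.range (s.orderEmbOfFin hs) := by
      change Set.range ((s.orderEmbOfFin hs) ∘ Fin.rev) = _
      rw [Function.Surjective.range_comp Fin.rev_surjective]
    rw [h1, Finset.range_orderEmbOfFin]
    simp [s]
  refine ⟨x, ⟨?_, ?_⟩, ?_⟩
  · intro i j hij
    exact (s.orderEmbOfFin hs).strictMono (Fin.rev_lt_rev.2 hij)
  · intro i
    obtain ⟨j, hj⟩ : x i ∈ Set.range y := hrange ▸ ⟨i, rfl⟩
    rw [← hj]; exact hy2 j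
  · change Set.range ((fun t => (polyOf a).eval t) ∘ x) = _
    rw [Set.range_comp, hrange, ← Set.range_comp]
    congr 1
    funext j
    exact hy1 j

theorem IsCrit.deriv_complex {m : ℕ} {a x : Fin m → ℝ} (h : IsCrit a x) {z : ℂ}
    (hz : (derivative ((polyOf a).map (algebraMap ℝ ℂ))).eval z = 0) : ∃ i, z = (x i : ℂ) := by
  rw [derivative_map, h.deriv_eq] at hz
  simp only [Polynomial.map_mul, Polynomial.map_prod, eval_mul, eval_prod, map_C, Polynomial.map_sub, map_X,
    eval_sub, eval_X, eval_C, mul_eq_zero, Finset.prod_eq_zero_iff] at hz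
  rcases hz with hz | ⟨i, -, hi⟩
  · exfalso
    have h1 : ((m : ℝ) + 1) ≠ 0 := by positivity
    have hz' : (algebraMap ℝ ℂ) ((m : ℝ) + 1) = 0 := hz
    exact h1 ((map_eq_zero _).1 hz')
  · exact ⟨i, sub_eq_zero.1 hi⟩

theorem ramType_of_crit {m : ℕ} {a x : Fin m → ℝ} (h : IsCrit a x)
    (hv : Function.Injective fun i => (polyOf a).eval (x i)) (i : Fin m) :
    ramType (polyOf a) ((polyOf a).eval (x i)) = 2 ::ₘ Multiset.replicate (m - 1) 1 := by
  unfold ramType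
  rw [map_sub_eq]
  set R := polyOf a - C ((polyOf a).eval (x i)) with hR
  have hRm : R.Monic := sub_C_monic a _
  set Q := R.map (algebraMap ℝ ℂ) with hQ
  have hQm : Q.Monic := hRm.map _
  have hdeg : R.natDegree = m + 1 := by rw [hR, natDegree_sub_C, polyOf_natDegree]
  have hmi : Q.rootMultiplicity (x i : ℂ) = 2 := by
    have := eq_rootMultiplicity_map (p := R) (f := algebraMap ℝ ℂ) (RingHom.injective _) (x i)
    rw [h.mult_crit i] at this
    exact this.symm
  have hmem : (x i : ℂ) ∈ Q.roots.toFinset := by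
    rw [Multiset.mem_toFinset, mem_roots hQm.ne_zero]
    exact (rootMultiplicity_pos hQm.ne_zero).1 (by omega)
  have hone : ∀ z ∈ Q.roots.toFinset.erase (x i : ℂ), Q.rootMultiplicity z = 1 := by
    intro z hz
    rw [Finset.mem_erase, Multiset.mem_toFinset, mem_roots hQm.ne_zero] at hz
    apply le_antisymm
    · by_contra hc
      push Not at hc
      have h1 := ((one_lt_rootMultiplicity_iff_isRoot hQm.ne_zero).1 hc).2
      have h2 : derivative Q = derivative ((polyOf a).map (algebraMap ℝ ℂ)) := by
        simp [hQ, hR]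
      rw [h2] at h1
      obtain ⟨k, rfl⟩ := h.deriv_complex h1
      have h3 : R.eval (x k) = 0 := by
        have := hz.2
        rw [IsRoot.def, hQ] at this
        have e2 : eval ((algebraMap ℝ ℂ) (x k)) (R.map (algebraMap ℝ ℂ)) = (algebraMap ℝ ℂ) (R.eval (x k)) := by
          rw [eval_map, eval₂_at_apply]
        have e3 : (algebraMap ℝ ℂ) (R.eval (x k)) = 0 := by rw [← e2]; exact this
        simpa using e3
      have h4 : k = i := hv (by simpa [hR, sub_eq_zero] using h3)
      exact hz.1 (by rw [h4])
    · exact (rootMultiplicity_pos hQm.ne_zero).2 hz.2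
  have hsum : ∑ z ∈ Q.roots.toFinset, Q.rootMultiplicity z = m + 1 := by
    have h1 := Multiset.toFinset_sum_count_eq Q.roots
    simp only [count_roots] at h1
    rw [h1, IsAlgClosed.card_roots_eq_natDegree, hQ, natDegree_map, hdeg]
  rw [← Finset.add_sum_erase _ _ hmem, hmi, Finset.sum_congr rfl hone] at hsum
  simp only [Finset.sum_const, smul_eq_mul, mul_one] at hsum
  have hins : Q.roots.toFinset.val = (x i : ℂ) ::ₘ (Q.roots.toFinset.erase (x i : ℂ)).val := by
    rw [Finset.erase_val, Multiset.cons_erase hmem]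
  rw [hins, Multiset.map_cons, hmi]
  congr 1
  rw [Multiset.eq_replicate]
  constructor
  · rw [Multiset.card_map, ← Finset.card_def]; omega
  · intro b hb
    obtain ⟨z, hz, rfl⟩ := Multiset.mem_map.1 hb
    exact hone z hz

theorem crit_unique {m : ℕ} {a x y : Fin m → ℝ} (hx : IsCrit a x) (hy : IsCrit a y) : x = y := by
  have h1 : StrictMono fun i => -x i := fun i j hij => neg_lt_neg (hx.1 hij)
  have h2 : StrictMono fun i => -y i := fun i j hij => neg_lt_neg (hy.1 hij)
  have h3 : (fun i => -x i) = fun i => -y i := by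
    rw [← h1.range_inj h2]
    ext t
    constructor
    · rintro ⟨i, rfl⟩
      obtain ⟨j, hj⟩ := (hy.root_iff (x i)).1 (hx.2 i)
      exact ⟨j, by simp only [hj]⟩
    · rintro ⟨i, rfl⟩
      obtain ⟨j, hj⟩ := (hx.root_iff (y i)).1 (hy.2 i)
      exact ⟨j, by simp only [hj]⟩
  funext i
  exact neg_injective (congrFun h3 i)

theorem alt_ofFn : ∀ (m : ℕ) (v : Fin m → ℝ) (b : Bool), alt b (List.ofFn v) ↔
    ∀ i : ℕ, ∀ h : i + 1 < m, 0 < (if b then 1 else -1) * ((-1) ^ i * (v ⟨i + 1, h⟩ - v ⟨i, by omega⟩))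
  | 0, v, b => by simp [alt]
  | 1, v, b => by simp [alt]
  | m + 2, v, b => by
    have ih := alt_ofFn (m + 1) (fun i => v i.succ) (!b)
    rw [List.ofFn_succ, List.ofFn_succ]
    rw [List.ofFn_succ] at ih
    simp only [alt]
    rw [ih]
    constructor
    · rintro ⟨h1, h2⟩ i hi
      cases i with
      | zero =>
        cases b
        · simp at h1 ⊢; exact h1
        · simp at h1 ⊢; exact h1
      | succ i =>
        have := h2 i (by omega)
        simp only [Fin.succ_mk] at this
        cases b <;> simp [pow_succ] at this ⊢ <;> linarith
    · intro h
      constructor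
      · have := h 0 (by omega)
        cases b
        · simp at this ⊢; exact this
        · simp at this ⊢; exact this
      · intro i hi
        have := h (i + 1) (by omega)
        simp only [Fin.succ_mk]
        cases b <;> simp [pow_succ] at this ⊢ <;> linarith

theorem alt_iff_altV {m : ℕ} (v : Fin m → ℝ) : alt true (List.ofFn v) ↔ altV v := by
  rw [alt_ofFn]; simp [altV]

def TT {m : ℕ} (w : Fin m → ℝ) : Set (Fin m → ℝ) :=
  {v | altV v ∧ Function.Injective v ∧ Set.range v = Set.range w}

theorem TT_ncard {m : ℕ} (w : Fin m → ℝ) (hw : Function.Injective w) :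
    (TT w).ncard = (altFin (Finset.univ.image w)).card := by
  have himg : (List.ofFn '' TT w) = ↑(altFin (Finset.univ.image w)) := by
    ext l
    rw [Finset.mem_coe, mem_altFin]
    constructor
    · rintro ⟨v, ⟨h1, h2, h3⟩, rfl⟩
      refine ⟨List.nodup_ofFn.2 h2, ?_, (alt_iff_altV v).2 h1⟩
      ext t
      have : t ∈ Set.range v ↔ t ∈ Set.range w := by rw [h3]
      simpa [List.mem_ofFn] using this
    · rintro ⟨h1, h2, h3⟩
      have hl : l.length = m := by
        rw [← List.toFinset_card_of_nodup h1, h2, Finset.card_image_of_injective _ hw]; simp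
      subst hl
      refine ⟨l.get, ⟨?_, ?_, ?_⟩, List.ofFn_get l⟩
      · rw [← alt_iff_altV, List.ofFn_get]; exact h3
      · exact List.nodup_iff_injective_get.1 h1
      · ext t
        have : t ∈ l.toFinset ↔ t ∈ Finset.univ.image w := by rw [h2]
        simpa [List.mem_iff_get] using this
  rw [← Set.ncard_coe_finset, ← himg, Set.ncard_image_of_injective _ List.ofFn_injective]

theorem simpleSet_eq {m : ℕ} (hm : 0 < m) (w : Fin m → ℝ) (hw : Function.Injective w) (P : ℝ[X]) :
    P ∈ simpleSet (m + 1) w ↔ ∃ z : ZZ m, (piV z).1 ∈ TT w ∧ polyOf z.1.1 = P := by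
  constructor
  · rintro ⟨⟨h1, h2, h3⟩, h4⟩
    obtain ⟨a, rfl⟩ := exists_polyOf P h1 h2 h3
    obtain ⟨x, hx, hr⟩ := crit_of_simple hw h4
    refine ⟨⟨(a, x), hx⟩, ⟨(piV _).2, ?_, hr⟩, rfl⟩
    have hfin := Finset.card_image_of_injective Finset.univ hw
    have : Finset.univ.image (fun i => (polyOf a).eval (x i)) = Finset.univ.image w := by
      ext t
      have : t ∈ Set.range (fun i => (polyOf a).eval (x i)) ↔ t ∈ Set.range w := by rw [hr]
      simpa using this
    rw [← this] at hfin
    exact fun i j hij => Finset.card_image_iff.1 hfin (by simp) (by simp) hij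
  · rintro ⟨z, ⟨h1, h2, h3⟩, rfl⟩
    refine ⟨⟨polyOf_natDegree _, polyOf_monic _, ?_⟩, fun j => ?_⟩
    · rw [polyOf_coeff]; simp
    · obtain ⟨i, hi⟩ : w j ∈ Set.range (piV z).1 := h3 ▸ ⟨j, rfl⟩
      rw [← hi]
      exact ramType_of_crit z.2 h2 i

theorem simpleSet_ncard {m : ℕ} (hm : 0 < m) (w : Fin m → ℝ) (hw : Function.Injective w) :
    (simpleSet (m + 1) w).ncard = (TT w).ncard := by
  have h1 : simpleSet (m + 1) w = (fun z : ZZ m => polyOf z.1.1) '' ((fun z => (piV z).1) ⁻¹' TT w) := by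
    ext P
    rw [simpleSet_eq hm w hw]; rfl
  have h2 : (fun z : ZZ m => (piV z).1) '' ((fun z => (piV z).1) ⁻¹' TT w) = TT w := by
    rw [Set.image_preimage_eq_iff]
    intro v hv
    obtain ⟨z, hz⟩ := (davis hm).2 ⟨v, hv.1⟩
    exact ⟨z, congrArg Subtype.val hz⟩
  rw [h1, Set.ncard_image_of_injective, ← h2, Set.ncard_image_of_injective, h2]
  · exact Subtype.val_injective.comp (davis hm).1
  · rintro ⟨⟨a, x⟩, hx⟩ ⟨⟨b, y⟩, hy⟩ h
    have hab : a = b := polyOf_injective h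
    subst hab
    have : x = y := crit_unique hx hy
    subst this
    rfl

theorem finsum_mem_one_ncard {α : Type*} (S : Set α) : ∑ᶠ P ∈ S, (1 : ℤ) = (S.ncard : ℤ) := by
  by_cases h : S.Finite
  · rw [finsum_mem_eq_finite_toFinset_sum _ h, Set.ncard_eq_toFinset_card _ h]; simp
  · rw [Set.Infinite.ncard h, finsum_mem_eq_zero_of_infinite]
    · simp
    · have : S ∩ Function.support (fun _ : α => (1 : ℤ)) = S := by
        rw [Function.support_const one_ne_zero, Set.inter_univ]
      rw [this]; exact h

theorem main_m {m : ℕ} (hm : 0 < m) (w : Fin m → ℝ) (hw : Function.Injective w) :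
    ((∑ᶠ P ∈ simpleSet (m + 1) w, epsilonP P : ℤ) : ℝ) = uN m := by
  have h1 : ∑ᶠ P ∈ simpleSet (m + 1) w, epsilonP P = ∑ᶠ P ∈ simpleSet (m + 1) w, (-1) ^ (m / 2) * 1 := by
    refine finsum_mem_congr rfl fun P hP => ?_
    obtain ⟨z, hz, rfl⟩ := (simpleSet_eq hm w hw P).1 hP
    rw [mul_one]
    exact epsilon_eq z.2 hz.2.1
  have hcard := card_altFin_rec aN aN_zero aN_one aN_rec m (Finset.univ.image w)
    (by rw [Finset.card_image_of_injective _ hw]; simp)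
  rw [h1, ← mul_finsum_mem, finsum_mem_one_ncard, simpleSet_ncard hm w hw, TT_ncard w hw]
  push_cast
  rw [hcard, aN, ← mul_assoc, ← mul_pow]
  simp

/-- `F^even_∅ = tanh` and `F^odd_∅ = 1/cosh`: the signed count of normalized real
degree-`n` polynomials with `n-1` prescribed simple real branch points equals the
`(n-1)`-st derivative at `0` of `tanh` if `n` is even, and of `1/cosh` if `n` is odd. -/
theorem simple_s_number_euler_bernoulli (n : ℕ) (hn : 2 ≤ n)
    (w : Fin (n - 1) → ℝ) (hw : StrictMono w) :
    ((∑ᶠ P ∈ simpleSet n w, epsilonP P : ℤ) : ℝ)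
      = if Even n then iteratedDeriv (n - 1) Real.tanh 0
        else iteratedDeriv (n - 1) (fun q : ℝ => 1 / Real.cosh q) 0 := by
  obtain ⟨m, rfl⟩ : ∃ m, n = m + 1 := ⟨n - 1, by omega⟩
  have h := main_m (m := m) (by omega) w hw.injective
  rw [h, uN]
  by_cases he : Even m
  · rw [if_pos he, if_neg (by simpa [Nat.even_add_one] using he)]
    rfl
  · rw [if_neg he, if_pos (by simpa [Nat.even_add_one] using he)]
    rfl
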